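/- Let O ∈ ℂ, r > 0, and for j = 0, 1, 2 let A_j := O + r·exp(2πij/3) be the vertices of an equilateral triangle with center O, listed counterclockwise. For j = 0, 1, 2 let l_j be an open polygonal line from A_{j+1} to A_{j+2} (indices mod 3) such that no edge of l_j meets the ray {O + t(A_j − O) : t ≥ 0}. Then the closed polygonal line l₀l₁l₂ (the concatenation of l₀, l₁, l₂) does not pass through O, and w(l₀l₁l₂, O) = 1. -/

import Mathlib

/-- The oriented angle `∠AOB ∈ (−π, π]` with vertex `O`. -/
noncomputable def oangle (O A B : ℂ) : ℝ := Complex.arg ((B - O) / (A - O))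

/-- The cyclic (oriented) edges of a closed polygonal line given by its list of vertices. -/
def cyc (l : List ℂ) : List (ℂ × ℂ) := l.zip (l.rotate 1)

/-- The (oriented) edges of an open polygonal line given by its list of vertices. -/
def opairs (l : List ℂ) : List (ℂ × ℂ) := l.zip l.tail

/-- A closed polygonal line passes through `X` if `X` lies on one of its edges. -/
def passes (l : List ℂ) (X : ℂ) : Prop := ∃ e ∈ cyc l, X ∈ segment ℝ e.1 e.2

/-- The winding number of a closed polygonal line around `O`. -/
noncomputable def wind (l : List ℂ) (O : ℂ) : ℝ :=
  ((cyc l).map (fun e => oangle O e.1 e.2)).sum / (2 * Real.pi)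

/-- On a segment inside the slit plane, the principal argument varies by the oriented angle. -/
theorem arg_div_of_segment_subset_slitPlane {z w : ℂ} (h : segment ℝ z w ⊆ Complex.slitPlane) :
    (w / z).arg = w.arg - z.arg := by
  have hz : z ∈ Complex.slitPlane := h (left_mem_segment ℝ z w)
  have hw : w ∈ Complex.slitPlane := h (right_mem_segment ℝ z w)
  have hz0 := Complex.slitPlane_ne_zero hz
  have hw0 := Complex.slitPlane_ne_zero hw
  have hzpi := Complex.slitPlane_arg_ne_pi hz
  have hwpi := Complex.slitPlane_arg_ne_pi hw
  have hinv : z⁻¹.arg = -z.arg := by rw [Complex.arg_inv, if_neg hzpi]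
  have hsin : ‖z‖ * ‖w‖ * Real.sin (w.arg - z.arg) = z.re * w.im - w.re * z.im := by
    rw [Real.sin_sub]
    linear_combination ‖z‖ * Real.cos z.arg * Complex.norm_mul_sin_arg w
      + w.im * Complex.norm_mul_cos_arg z - ‖z‖ * Real.sin z.arg * Complex.norm_mul_cos_arg w
      - w.re * Complex.norm_mul_sin_arg z
  have hcross (hd : z.im * w.im < 0) : 0 < (z.re * w.im - w.re * z.im) * (w.im - z.im) := by
    have hne : w.im - z.im ≠ 0 := by
      intro h0
      rw [sub_eq_zero.mp h0] at hd
      exact (mul_self_nonneg _).not_gt hd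
    have hsq : 0 < (w.im - z.im) ^ 2 := by positivity
    have ha : 0 ≤ w.im / (w.im - z.im) := by
      rw [← mul_div_mul_right _ _ hne]
      exact div_nonneg (by nlinarith [sq_nonneg w.im]) (by nlinarith)
    have hb : 0 ≤ -z.im / (w.im - z.im) := by
      rw [← mul_div_mul_right _ _ hne]
      exact div_nonneg (by nlinarith [sq_nonneg z.im]) (by nlinarith)
    have hmem := h ⟨_, _, ha, hb, by field_simp; ring, rfl⟩
    rw [Complex.mem_slitPlane_iff] at hmem
    simp only [Complex.add_re, Complex.add_im, Complex.real_smul, Complex.re_ofReal_mul,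
      Complex.im_ofReal_mul] at hmem
    rcases hmem with hre | him
    · have := mul_pos hre hsq
      field_simp at this
      linarith
    · exact absurd (by field_simp; ring) him
  have hpos : 0 < ‖z‖ * ‖w‖ := mul_pos (norm_pos_iff.mpr hz0) (norm_pos_iff.mpr hw0)
  have hz1 := Complex.neg_pi_lt_arg z
  have hz2 := (Complex.arg_le_pi z).lt_of_ne hzpi
  have hw1 := Complex.neg_pi_lt_arg w
  have hw2 := (Complex.arg_le_pi w).lt_of_ne hwpi
  have key : w.arg + z⁻¹.arg ∈ Set.Ioc (-Real.pi) Real.pi := by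
    rw [hinv]
    constructor
    · by_contra! hle
      have him_z : 0 < z.im := by
        rw [← Complex.norm_mul_sin_arg z]
        exact mul_pos (norm_pos_iff.mpr hz0) (Real.sin_pos_of_pos_of_lt_pi (by linarith) hz2)
      have him_w : w.im < 0 := by
        rw [← Complex.norm_mul_sin_arg w]
        exact mul_neg_of_pos_of_neg (norm_pos_iff.mpr hw0)
          (Real.sin_neg_of_neg_of_neg_pi_lt (by linarith) hw1)
      have hs : 0 ≤ Real.sin (w.arg - z.arg) := by
        rw [← Real.sin_add_two_pi]
        exact Real.sin_nonneg_of_nonneg_of_le_pi (by linarith) (by linarith)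
      have := hcross (mul_neg_of_pos_of_neg him_z him_w)
      rw [← hsin] at this
      nlinarith [mul_nonneg hpos.le hs]
    · by_contra! hlt
      have him_z : z.im < 0 := by
        rw [← Complex.norm_mul_sin_arg z]
        exact mul_neg_of_pos_of_neg (norm_pos_iff.mpr hz0)
          (Real.sin_neg_of_neg_of_neg_pi_lt (by linarith) hz1)
      have him_w : 0 < w.im := by
        rw [← Complex.norm_mul_sin_arg w]
        exact mul_pos (norm_pos_iff.mpr hw0) (Real.sin_pos_of_pos_of_lt_pi (by linarith) hw2)
      have hs : Real.sin (w.arg - z.arg) ≤ 0 := by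
        rw [← Real.sin_sub_two_pi]
        exact Real.sin_nonpos_of_nonpos_of_neg_pi_le (by linarith) (by linarith)
      have := hcross (mul_neg_of_neg_of_pos him_z him_w)
      rw [← hsin] at this
      nlinarith [mul_nonneg hpos.le (neg_nonneg.mpr hs)]
  rw [div_eq_mul_inv, (Complex.arg_mul_eq_add_arg_iff hw0 (inv_ne_zero hz0)).mpr key, hinv,
    sub_eq_add_neg]

/-- The angle under which a segment avoiding a ray is seen from the origin of the ray. -/
theorem oangle_eq_of_avoids_ray {O u P Q : ℂ} (hu : u ≠ 0)
    (h : ∀ t : ℝ, 0 ≤ t → O + (t : ℂ) * u ∉ segment ℝ P Q) :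
    oangle O P Q = (-(Q - O) / u).arg - (-(P - O) / u).arg := by
  have hP : P - O ≠ 0 := by
    intro h0
    refine h 0 le_rfl ?_
    rw [← sub_eq_zero.mp h0]
    simpa using left_mem_segment ℝ P Q
  rw [← arg_div_of_segment_subset_slitPlane, oangle]
  · congr 1
    field_simp
  · rintro _ ⟨a, b, ha, hb, hab, rfl⟩
    rw [Complex.mem_slitPlane_iff_not_le_zero]
    intro hle
    obtain ⟨hre, him⟩ := Complex.le_def.mp hle
    set x := a • (-(P - O) / u) + b • (-(Q - O) / u) with hx
    have hxre : x = (x.re : ℂ) := Complex.ext rfl (by simpa using him)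
    refine h (-x.re) (by simpa using hre) ⟨a, b, ha, hb, hab, ?_⟩
    rw [Complex.ofReal_neg, ← hxre, hx]
    have hab' : (a : ℂ) + b = 1 := by exact_mod_cast hab
    simp only [Complex.real_smul]
    field_simp
    linear_combination O * hab'

/-- The total angle along an open polygonal line avoiding a ray. -/
theorem sum_oangle_eq_of_avoids_ray {O u : ℂ} (hu : u ≠ 0) {a b : ℂ} {s : List ℂ}
    (hb : (a :: s).getLast? = some b)
    (h : ∀ e ∈ opairs (a :: s), ∀ t : ℝ, 0 ≤ t → O + (t : ℂ) * u ∉ segment ℝ e.1 e.2) :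
    ((opairs (a :: s)).map (fun e => oangle O e.1 e.2)).sum
      = (-(b - O) / u).arg - (-(a - O) / u).arg := by
  induction s generalizing a with
  | nil =>
    obtain rfl : a = b := by simpa using hb
    simp [opairs]
  | cons c s ih =>
    have hcons : opairs (a :: c :: s) = (a, c) :: opairs (c :: s) := rfl
    rw [hcons] at h ⊢
    rw [List.map_cons, List.sum_cons, ih (by simpa using hb) fun e he => h e (by simp [he]),
      oangle_eq_of_avoids_ray hu (h (a, c) (by simp))]
    ring

theorem opairs_append {a b : ℂ} {s : List ℂ} (hb : (a :: s).getLast? = some b) (t : List ℂ) :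
    opairs (a :: s ++ t) = opairs (a :: s) ++ opairs (b :: t) := by
  induction s generalizing a with
  | nil =>
    obtain rfl : a = b := by simpa using hb
    simp [opairs]
  | cons c s ih =>
    have := ih (a := c) (by simpa using hb)
    simpa [opairs] using this

/-- The edges of a closed polygonal line are those of the open line returning to its start. -/
theorem cyc_cons (a : ℂ) (s : List ℂ) : cyc (a :: s) = opairs (a :: s ++ [a]) := by
  have := List.zip_append (l₁ := a :: s) (r₁ := [a]) (l₂ := s ++ [a]) (r₂ := []) (by simp)
  simp only [List.append_nil, List.zip_nil_right] at this
  simp [cyc, opairs, List.rotate_cons_succ] at this ⊢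
  exact this.symm

theorem arg_neg_exp_two_pi_div_three :
    (-Complex.exp (2 * (Real.pi : ℂ) * Complex.I / 3)).arg = -(Real.pi / 3) := by
  have hpi := Real.pi_pos
  have : -Complex.exp (2 * (Real.pi : ℂ) * Complex.I / 3)
      = Complex.exp ((-(Real.pi / 3) : ℝ) * Complex.I) := by
    rw [← Complex.exp_sub_pi_mul_I]
    congr 1
    push_cast
    ring
  rw [this, Complex.arg_exp_mul_I, toIocMod_eq_self]
  constructor <;> linarith

theorem arg_neg_exp_four_pi_div_three :
    (-Complex.exp (2 * (Real.pi : ℂ) * Complex.I / 3) ^ 2).arg = Real.pi / 3 := by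
  have hpi := Real.pi_pos
  have : -Complex.exp (2 * (Real.pi : ℂ) * Complex.I / 3) ^ 2
      = Complex.exp ((Real.pi / 3 : ℝ) * Complex.I) := by
    rw [← Complex.exp_nat_mul, ← Complex.exp_sub_pi_mul_I]
    congr 1
    push_cast
    ring
  rw [this, Complex.arg_exp_mul_I, toIocMod_eq_self]
  constructor <;> linarith

theorem stmt10 (O : ℂ) (r : ℝ) (hr : 0 < r) (A : ℕ → ℂ)
    (hA : ∀ j : ℕ, A j = O + (r : ℂ) * Complex.exp (2 * (Real.pi : ℂ) * Complex.I * (j : ℂ) / 3))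
    (l0 l1 l2 : List ℂ)
    (h0A : l0.head? = some (A 1)) (h0B : l0.getLast? = some (A 2))
    (h0ray : ∀ e ∈ opairs l0, ∀ t : ℝ, 0 ≤ t → O + (t : ℂ) * (A 0 - O) ∉ segment ℝ e.1 e.2)
    (h1A : l1.head? = some (A 2)) (h1B : l1.getLast? = some (A 0))
    (h1ray : ∀ e ∈ opairs l1, ∀ t : ℝ, 0 ≤ t → O + (t : ℂ) * (A 1 - O) ∉ segment ℝ e.1 e.2)
    (h2A : l2.head? = some (A 0)) (h2B : l2.getLast? = some (A 1))
    (h2ray : ∀ e ∈ opairs l2, ∀ t : ℝ, 0 ≤ t → O + (t : ℂ) * (A 2 - O) ∉ segment ℝ e.1 e.2) :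
    ¬ passes (l0 ++ l1.tail ++ l2.tail.dropLast) O ∧
    wind (l0 ++ l1.tail ++ l2.tail.dropLast) O = 1 := by
  obtain ⟨s0, rfl⟩ := List.head?_eq_some_iff.mp h0A
  obtain ⟨s1, rfl⟩ := List.head?_eq_some_iff.mp h1A
  obtain ⟨s2, rfl⟩ := List.head?_eq_some_iff.mp h2A
  set ω := Complex.exp (2 * (Real.pi : ℂ) * Complex.I / 3) with hω
  have hr0 : (r : ℂ) ≠ 0 := by exact_mod_cast hr.ne'
  have hω0 : ω ≠ 0 := Complex.exp_ne_zero _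
  have hω3 : ω ^ 3 = 1 := by
    rw [hω, ← Complex.exp_nat_mul, ← Complex.exp_two_pi_mul_I]
    congr 1
    push_cast
    ring
  have hA' (j : ℕ) : A j - O = r * ω ^ j := by
    rw [hA, hω, ← Complex.exp_nat_mul, add_sub_cancel_left]
    congr 2
    ring
  have harg1 : (-ω).arg = -(Real.pi / 3) := arg_neg_exp_two_pi_div_three
  have harg2 : (-ω ^ 2).arg = Real.pi / 3 := arg_neg_exp_four_pi_div_three
  have hA01 : A 0 ≠ A 1 := by
    intro h01
    have h1 : ω = 1 := by
      have := (hA' 1).symm.trans ((congrArg (· - O) h01).symm.trans (hA' 0))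
      simpa using mul_left_cancel₀ hr0 this
    rw [h1] at harg1
    simp only [Complex.arg_neg_one] at harg1
    linarith [Real.pi_pos]
  have hne (j : ℕ) : A j - O ≠ 0 := by
    rw [hA']
    exact mul_ne_zero hr0 (pow_ne_zero _ hω0)
  have hsum {i j k : ℕ} {s : List ℂ} (hk : (A j :: s).getLast? = some (A k))
      (h : ∀ e ∈ opairs (A j :: s), ∀ t : ℝ, 0 ≤ t →
        O + (t : ℂ) * (A i - O) ∉ segment ℝ e.1 e.2)
      (hij : ω ^ j = ω ^ i * ω) (hik : ω ^ k = ω ^ i * ω ^ 2) :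
      ((opairs (A j :: s)).map (fun e => oangle O e.1 e.2)).sum = 2 * Real.pi / 3 := by
    have hωi : ω ^ i ≠ 0 := pow_ne_zero _ hω0
    have h1 : -(A j - O) / (A i - O) = -ω := by
      rw [hA', hA', hij]
      field_simp
    have h2 : -(A k - O) / (A i - O) = -ω ^ 2 := by
      rw [hA', hA', hik]
      field_simp
    rw [sum_oangle_eq_of_avoids_ray (hne i) hk h, h1, h2, harg1, harg2]
    ring
  have hcyc : cyc (A 1 :: s0 ++ (A 2 :: s1).tail ++ (A 0 :: s2).tail.dropLast)
      = opairs (A 1 :: s0) ++ opairs (A 2 :: s1) ++ opairs (A 0 :: s2) := by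
    have hs2 : s2.dropLast ++ [A 1] = s2 := by
      apply List.dropLast_append_getLast?
      cases s2 with
      | nil => exact absurd (by simpa using h2B) hA01
      | cons c s => simpa using h2B
    have h := cyc_cons (A 1) (s0 ++ s1 ++ s2.dropLast)
    simp only [List.tail_cons, List.cons_append, List.append_assoc, hs2] at h ⊢
    rw [h, ← List.cons_append, opairs_append h0B, ← List.cons_append, opairs_append h1B]
  constructor
  · rintro ⟨e, he, hO⟩
    rw [hcyc, List.mem_append, List.mem_append] at he
    rcases he with (he | he) | he
    · exact h0ray e he 0 le_rfl (by simpa using hO)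
    · exact h1ray e he 0 le_rfl (by simpa using hO)
    · exact h2ray e he 0 le_rfl (by simpa using hO)
  · rw [wind, hcyc, List.map_append, List.map_append, List.sum_append, List.sum_append,
      hsum h0B h0ray (by ring) (by ring),
      hsum h1B h1ray (by ring) (by linear_combination -hω3),
      hsum h2B h2ray (by linear_combination -hω3) (by linear_combination -ω * hω3)]
    have := Real.pi_pos
    field_simp
    norm_num
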